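/- arXiv:2004.01605 — 6 statements merged into one kernel-verified Lean document; each statement's English description precedes it below -/
import Mathlib

section
/- Let n_p, m_p ∈ ℕ, A ∈ ℝ^{n_p×n_p}, B ∈ ℝ^{n_p×m_p}, K ∈ ℝ^{m_p×n_p}, H ≥ 1 an integer, and Ω_p, W_p ⊆ ℝ^{n_p} with 0 ∈ Ω_p. Suppose that for all i ∈ {1,…,H} the inclusion (A_i + B_i K)''Ω_p ⊕ (⊕_{j=0}^{i−1} A^j''W_p) ⊆ Ω_p holds. Then for every e₀ ∈ Ω_p and every w : ℕ → ℝ^{n_p} with w(j) ∈ W_p for all j ∈ {0,…,H−1}, the error sequence defined by e(0) = e₀ and e(i+1) = A e(i) + B K e₀ + w(i) satisfies e(i) ∈ Ω_p for all i ∈ {1,…,H}. -/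
open Pointwise

/-- Variation-of-constants formula for `e (i + 1) = A e(i) + B K e(0) + w(i)`, where the
feedback `K` only sees the initial value. -/
theorem error_eq_mulVec_add_sum {n m R : Type*} [Fintype n] [DecidableEq n] [Fintype m]
    [CommRing R] (A : Matrix n n R) (B : Matrix n m R) (K : Matrix m n R) (w e : ℕ → n → R)
    (he : ∀ i, e (i + 1) = A.mulVec (e i) + B.mulVec (K.mulVec (e 0)) + w i) (i : ℕ) :
    e i = (A ^ i + (∑ j ∈ Finset.range i, A ^ j) * B * K).mulVec (e 0) +
      ∑ j ∈ Finset.range i, (A ^ j).mulVec (w (i - 1 - j)) := by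
  induction i with
  | zero => simp
  | succ k ih =>
    have hgeom : ∑ j ∈ Finset.range (k + 1), A ^ j = A * ∑ j ∈ Finset.range k, A ^ j + 1 := by
      simp [Finset.sum_range_succ', Finset.mul_sum, pow_succ']
    have hdist : ∑ j ∈ Finset.range (k + 1), (A ^ j).mulVec (w (k + 1 - 1 - j)) =
        A.mulVec (∑ j ∈ Finset.range k, (A ^ j).mulVec (w (k - 1 - j))) + w k := by
      rw [Finset.sum_range_succ', Matrix.mulVec_sum]
      congr 1
      · refine Finset.sum_congr rfl fun j _ => ?_
        rw [Matrix.mulVec_mulVec, ← pow_succ', show k + 1 - 1 - (j + 1) = k - 1 - j by lia]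
      · simp
    rw [he, hgeom, hdist, ih]
    simp only [Matrix.mulVec_add, Matrix.add_mulVec, Matrix.mulVec_mulVec, pow_succ',
      Matrix.add_mul, Matrix.one_mul, Matrix.mul_assoc]
    abel

/-- If `Ω_p` satisfies the `[1,H]` robust invariance condition
`(Aᵢ + Bᵢ K)''Ω_p ⊕ (⊕_{j<i} Aʲ''W_p) ⊆ Ω_p` for all `i ∈ {1,…,H}`, then the error
sequence `e(0) = e₀ ∈ Ω_p`, `e(i+1) = A e(i) + B K e₀ + w(i)` with `w(j) ∈ W_p`
stays in `Ω_p` for all `i ∈ {1,…,H}`. -/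
theorem stmt_1 (np mp H : ℕ) (hH : 1 ≤ H)
    (A : Matrix (Fin np) (Fin np) ℝ) (B : Matrix (Fin np) (Fin mp) ℝ)
    (K : Matrix (Fin mp) (Fin np) ℝ)
    (Ωp Wp : Set (Fin np → ℝ)) (hΩ0 : (0 : Fin np → ℝ) ∈ Ωp)
    (hinv : ∀ i ∈ Finset.Icc 1 H,
      (fun x => (A ^ i + (∑ j ∈ Finset.range i, A ^ j) * B * K).mulVec x) '' Ωp +
        ∑ j ∈ Finset.range i, (fun y => (A ^ j).mulVec y) '' Wp ⊆ Ωp)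
    (e₀ : Fin np → ℝ) (he₀ : e₀ ∈ Ωp)
    (w : ℕ → Fin np → ℝ) (hw : ∀ j < H, w j ∈ Wp)
    (e : ℕ → Fin np → ℝ) (he0 : e 0 = e₀)
    (he : ∀ i, e (i + 1) = A.mulVec (e i) + B.mulVec (K.mulVec e₀) + w i) :
    ∀ i ∈ Finset.Icc 1 H, e i ∈ Ωp := by
  intro i hi
  subst he0
  rw [error_eq_mulVec_add_sum A B K w e he i]
  refine hinv i hi (Set.add_mem_add (Set.mem_image_of_mem _ he₀) ?_)
  refine Set.finsetSum_mem_finsetSum _ _ _ fun j hj => Set.mem_image_of_mem _ (hw _ ?_)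
  rw [Finset.mem_Icc] at hi
  lia
end

section
/- Let Ω_p, W_p ⊆ ℝ^{n_p} with 0 ∈ Ω_p, K ∈ ℝ^{m_p×n_p}, and H ≥ 1 an integer such that (A_i + B_i K)''Ω_p ⊕ (⊕_{j=0}^{i−1} A^j''W_p) ⊆ Ω_p for all i ∈ {1,…,H}. Define Ω := Ω_p × K''Ω_p × {0} ⊆ ℝ^{n_p} × ℝ^{m_p} × ℤ. Then Ω is a [1,H] robust control invariant set for the NCS error under the feedback φ(v_c, x_p, x̄_p) = v_c + K(x_p − x̄_p): for all initial states x(0) = (x_p(0), u_s(0), β(0)) and x̄(0) = (x̄_p(0), ū_s(0), β̄(0)) with x(0) − x̄(0) ∈ Ω, for every v_c ∈ ℝ^{m_p} and every disturbance sequence with w_p(i) ∈ W_p for i ∈ {0,…,H−1}, the nominal trajectory x̄(i+1) = f(x̄(i), v̄(i)) with v̄(0) = (v_c, 1) and v̄(i) = (0, 0) for i ∈ {1,…,H−1}, and the real trajectory x(i+1) = f(x(i), u(i)) + (w_p(i), 0, 0) with u(0) = (v_c + K(x_p(0) − x̄_p(0)), 1) and u(i) = (0, 0) for i ∈ {1,…,H−1},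 satisfy x(i) − x̄(i) ∈ Ω for all i ∈ {1,…,H}. -/
open Pointwise

/-- The NCS dynamics: state `x = (x_p, u_s, β)`, input `u = (u_c, γ)` with `γ ∈ {0,1}`;
`f(x,u) = (A x_p + B((1-γ)u_s + γ u_c), (1-γ)u_s + γ u_c, min(β + g - γ c, b))`. -/
noncomputable def ncsF {np mp : ℕ} (A : Matrix (Fin np) (Fin np) ℝ)
    (B : Matrix (Fin np) (Fin mp) ℝ) (g c b : ℤ)
    (x : (Fin np → ℝ) × (Fin mp → ℝ) × ℤ) (u : (Fin mp → ℝ) × ℤ) :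
    (Fin np → ℝ) × (Fin mp → ℝ) × ℤ :=
  (A.mulVec x.1 + B.mulVec ((1 - (u.2 : ℝ)) • x.2.1 + (u.2 : ℝ) • u.1),
   (1 - (u.2 : ℝ)) • x.2.1 + (u.2 : ℝ) • u.1,
   min (x.2.2 + g - u.2 * c) b)

/-- Variation of constants for `e (i+1) = A e(i) + B K e(0) + w(i)`. -/
theorem affine_recursion_solution {np mp : ℕ} (A : Matrix (Fin np) (Fin np) ℝ)
    (B : Matrix (Fin np) (Fin mp) ℝ) (K : Matrix (Fin mp) (Fin np) ℝ)
    (e w : ℕ → Fin np → ℝ) (H : ℕ)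
    (he : ∀ i < H, e (i + 1) = A.mulVec (e i) + B.mulVec (K.mulVec (e 0)) + w i) :
    ∀ i ≤ H, e i = (A ^ i + (∑ j ∈ Finset.range i, A ^ j) * B * K).mulVec (e 0)
      + ∑ j ∈ Finset.range i, (A ^ j).mulVec (w (i - 1 - j)) := by
  intro i
  induction i with
  | zero => intro _; simp
  | succ k ih =>
    intro hk
    have hS : A ^ (k + 1) + (∑ j ∈ Finset.range (k + 1), A ^ j) * B * K
        = A * (A ^ k + (∑ j ∈ Finset.range k, A ^ j) * B * K) + B * K := by
      rw [Finset.sum_range_succ']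
      simp only [pow_succ', ← Finset.mul_sum, pow_zero, mul_add, Matrix.add_mul,
        Matrix.one_mul, Matrix.mul_assoc]
      abel
    have hD : ∑ j ∈ Finset.range (k + 1), (A ^ j).mulVec (w (k + 1 - 1 - j))
        = A.mulVec (∑ j ∈ Finset.range k, (A ^ j).mulVec (w (k - 1 - j))) + w k := by
      rw [Finset.sum_range_succ', Matrix.mulVec_sum]
      congr 1
      · refine Finset.sum_congr rfl fun j _ => ?_
        rw [Matrix.mulVec_mulVec, ← pow_succ', show k + 1 - 1 - (j + 1) = k - 1 - j by omega]
      · simp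
    rw [he k (by omega), hS, hD, ih (by omega)]
    simp only [Matrix.add_mulVec, Matrix.mulVec_add, ← Matrix.mulVec_mulVec]
    abel

/-- Two states with the same bucket level, driven by transmitted inputs: the successor error. -/
theorem ncsF_sub_of_transmit {np mp : ℕ} (A : Matrix (Fin np) (Fin np) ℝ)
    (B : Matrix (Fin np) (Fin mp) ℝ) (g c b : ℤ)
    (x y : (Fin np → ℝ) × (Fin mp → ℝ) × ℤ) (hβ : x.2.2 - y.2.2 = 0)
    (u v : Fin mp → ℝ) (w : Fin np → ℝ) :
    ncsF A B g c b x (v + u, 1) + (w, 0, 0) - ncsF A B g c b y (v, 1)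
      = (A.mulVec (x.1 - y.1) + B.mulVec u + w, u, 0) := by
  refine Prod.ext ?_ (Prod.ext ?_ ?_)
  · simp [ncsF, Matrix.mulVec_sub, Matrix.mulVec_add]
    abel
  · simp [ncsF]
  · simp [ncsF, sub_eq_zero.mp hβ]

/-- Two states with the same bucket level, both holding their stored input: the successor error. -/
theorem ncsF_sub_of_hold {np mp : ℕ} (A : Matrix (Fin np) (Fin np) ℝ)
    (B : Matrix (Fin np) (Fin mp) ℝ) (g c b : ℤ)
    (x y : (Fin np → ℝ) × (Fin mp → ℝ) × ℤ) (hβ : x.2.2 - y.2.2 = 0) (w : Fin np → ℝ) :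
    ncsF A B g c b x (0, 0) + (w, 0, 0) - ncsF A B g c b y (0, 0)
      = (A.mulVec (x.1 - y.1) + B.mulVec (x.2.1 - y.2.1) + w, x.2.1 - y.2.1, 0) := by
  refine Prod.ext ?_ (Prod.ext ?_ ?_)
  · simp [ncsF, Matrix.mulVec_sub]
    abel
  · simp [ncsF]
  · simp [ncsF, sub_eq_zero.mp hβ]

/-- `Ω := Ω_p × K''Ω_p × {0}` is a `[1,H]` robust control invariant set
for the NCS error under the feedback `φ(v_c, x_p, x̄_p) = v_c + K(x_p - x̄_p)`. -/
theorem stmt_2 (np mp H : ℕ) (hH : 1 ≤ H)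
    (A : Matrix (Fin np) (Fin np) ℝ) (B : Matrix (Fin np) (Fin mp) ℝ)
    (K : Matrix (Fin mp) (Fin np) ℝ)
    (g c b : ℤ) (hg : 1 ≤ g) (hc : g ≤ c) (hb : c - g ≤ b)
    (Ωp Wp : Set (Fin np → ℝ)) (hΩ0 : (0 : Fin np → ℝ) ∈ Ωp)
    (hinv : ∀ i ∈ Finset.Icc 1 H,
      (fun x => (A ^ i + (∑ j ∈ Finset.range i, A ^ j) * B * K).mulVec x) '' Ωp +
        ∑ j ∈ Finset.range i, (fun y => (A ^ j).mulVec y) '' Wp ⊆ Ωp)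
    (x xbar : ℕ → (Fin np → ℝ) × (Fin mp → ℝ) × ℤ)
    (hx0 : x 0 - xbar 0 ∈ Ωp ×ˢ ((fun y => K.mulVec y) '' Ωp) ×ˢ ({0} : Set ℤ))
    (vc : Fin mp → ℝ) (wp : ℕ → Fin np → ℝ) (hw : ∀ i < H, wp i ∈ Wp)
    (hxbar1 : xbar 1 = ncsF A B g c b (xbar 0) (vc, 1))
    (hxbar : ∀ i ∈ Finset.Icc 1 (H - 1), xbar (i + 1) = ncsF A B g c b (xbar i) (0, 0))
    (hx1 : x 1 = ncsF A B g c b (x 0) (vc + K.mulVec ((x 0).1 - (xbar 0).1), 1)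
      + (wp 0, 0, 0))
    (hxr : ∀ i ∈ Finset.Icc 1 (H - 1), x (i + 1) = ncsF A B g c b (x i) (0, 0)
      + (wp i, 0, 0)) :
    ∀ i ∈ Finset.Icc 1 H,
      x i - xbar i ∈ Ωp ×ˢ ((fun y => K.mulVec y) '' Ωp) ×ˢ ({0} : Set ℤ) := by
  obtain ⟨h0, -, hβ⟩ := hx0
  have hfirst : x 1 - xbar 1 = (A.mulVec ((x 0).1 - (xbar 0).1)
      + B.mulVec (K.mulVec ((x 0).1 - (xbar 0).1)) + wp 0,
      K.mulVec ((x 0).1 - (xbar 0).1), 0) := by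
    rw [hx1, hxbar1, ncsF_sub_of_transmit A B g c b _ _ hβ]
  have hstep : ∀ i < H, x (i + 1) - xbar (i + 1) = (A.mulVec ((x i).1 - (xbar i).1)
      + B.mulVec (K.mulVec ((x 0).1 - (xbar 0).1)) + wp i,
      K.mulVec ((x 0).1 - (xbar 0).1), 0) := by
    intro i
    induction i with
    | zero => exact fun _ => hfirst
    | succ k ih =>
      intro hk
      have hprev := ih (by omega)
      have hus : (x (k + 1)).2.1 - (xbar (k + 1)).2.1 = K.mulVec ((x 0).1 - (xbar 0).1) :=
        congrArg (fun z => z.2.1) hprev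
      have hmem : k + 1 ∈ Finset.Icc 1 (H - 1) := Finset.mem_Icc.mpr (by omega)
      rw [hxr _ hmem, hxbar _ hmem,
        ncsF_sub_of_hold A B g c b _ _ (congrArg (fun z => z.2.2) hprev), hus]
  have hsol := affine_recursion_solution A B K (fun i => (x i).1 - (xbar i).1) wp H
    fun i hi => congrArg Prod.fst (hstep i hi)
  intro i hi
  have hi' := Finset.mem_Icc.mp hi
  obtain ⟨k, rfl⟩ : ∃ k, i = k + 1 := ⟨i - 1, by omega⟩
  have hk := hstep k (by omega)
  refine ⟨?_, ?_, ?_⟩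
  · refine hinv _ hi ?_
    change (x (k + 1)).1 - (xbar (k + 1)).1 ∈ _
    rw [hsol _ hi'.2]
    refine Set.add_mem_add ⟨_, h0, rfl⟩ (Set.finsetSum_mem_finsetSum _ _ _ fun j hj => ?_)
    exact ⟨_, hw _ (by omega), rfl⟩
  · rw [hk]
    exact ⟨_, h0, rfl⟩
  · rw [hk]
    rfl
end

section
/- Let M ≥ 1, H ≥ M and N̄ ≥ H be integers and define the cyclic prediction horizon N(k) := N̄ − (k mod M) for k ∈ ℕ. Let k̄ ∈ ℕ, let γ : ℕ → {0,1} be a closed-loop transmission sequence and s : ℕ → ℕ a counter with s(0) = 0 and s(k+1) = 0 if γ(k) = 1, s(k+1) = s(k) + 1 if γ(k) = 0. Suppose that for every k ∈ {0,…,k̄−1} there exists a schedule σ_k ∈ Γ_{N(k)}^H(s(k)) with σ_k(0) = γ(k). Then for every k ∈ ℕ with 0 ≤ k ≤ k̄ − H it holds that Σ_{i=k}^{k+H−1} γ(i) ≥ 1, i.e., the closed loop transmits at least once in every window of H consecutive time steps. -/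
/-- The schedule-constraint set `Γ_N^H(s)`: `σ` is a `{0,1}`-valued schedule of length `N`
such that either `N ≤ H - s - 1`, or `σ` has at least one transmission and, writing
`τ(0) < … < τ(n)` for the transmission indices, `τ(0) ≤ H - s - 1`, consecutive
transmissions are at most `H` apart, and `N - τ(n) ≤ H - 1`. -/
def Gamma (N H s : ℕ) (σ : ℕ → ℕ) : Prop :=
  (∀ j < N, σ j = 0 ∨ σ j = 1) ∧
  ((N : ℤ) ≤ (H : ℤ) - (s : ℤ) - 1 ∨
    ∃ (n : ℕ) (τ : Fin (n + 1) → ℕ),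
      StrictMono τ ∧
      (∀ j, (j < N ∧ σ j = 1) ↔ ∃ i, τ i = j) ∧
      ((τ 0 : ℤ) ≤ (H : ℤ) - (s : ℤ) - 1) ∧
      (∀ i : ℕ, ∀ h : i + 1 < n + 1,
        (τ ⟨i + 1, h⟩ : ℤ) - (τ ⟨i, Nat.lt_of_succ_lt h⟩ : ℤ) ≤ (H : ℤ)) ∧
      ((N : ℤ) - (τ (Fin.last n) : ℤ) ≤ (H : ℤ) - 1))

/-- If the counter has reached at least `H - 1`, every admissible schedule of positive length
transmits immediately. -/
theorem Gamma.apply_zero_eq_one {N H s : ℕ} {σ : ℕ → ℕ} (h : Gamma N H s σ) (hN : 0 < N)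
    (hs : H ≤ s + 1) : σ 0 = 1 := by
  obtain ⟨-, h | ⟨n, τ, -, hτ, h0, -, -⟩⟩ := h
  · omega
  · exact ((hτ 0).2 ⟨0, by omega⟩).2

/-- A counter which increases by one at each step without a transmission is at least `i` after
`i` such steps. -/
theorem le_counter_of_forall_eq_zero {γ s : ℕ → ℕ}
    (hs : ∀ k, s (k + 1) = if γ k = 1 then 0 else s k + 1) (k i : ℕ)
    (h : ∀ j < i, γ (k + j) = 0) : i ≤ s (k + i) := by
  induction i with
  | zero => exact Nat.zero_le _
  | succ i ih =>
    have hi := ih fun j hj => h j (by omega)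
    rw [← Nat.add_assoc, hs, h i (Nat.lt_succ_self i)]
    simpa using hi

/-- **Lemma 2.** Under the cyclic prediction horizon `N(k) = N̄ - (k mod M)`
with `N̄ ≥ H ≥ M ≥ 1`, if at each time `k < k̄` the applied transmission decision `γ(k)` is
the first entry of some schedule in `Γ_{N(k)}^H(s(k))`, then the closed loop transmits at
least once in every window of `H` consecutive steps contained in `[0, k̄]`. -/
theorem stmt_4 (M H Nbar : ℕ) (hM : 1 ≤ M) (hHM : M ≤ H) (hNH : H ≤ Nbar)
    (kbar : ℕ) (γ : ℕ → ℕ) (hγ : ∀ k, γ k = 0 ∨ γ k = 1)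
    (s : ℕ → ℕ) (hs0 : s 0 = 0)
    (hs : ∀ k, s (k + 1) = if γ k = 1 then 0 else s k + 1)
    (hsched : ∀ k < kbar, ∃ σ : ℕ → ℕ, Gamma (Nbar - k % M) H (s k) σ ∧ σ 0 = γ k) :
    ∀ k, k + H ≤ kbar → 1 ≤ ∑ i ∈ Finset.Ico k (k + H), γ i := by
  intro k hk
  by_contra hsum
  have hzero : ∀ j < H, γ (k + j) = 0 := fun j hj =>
    Finset.sum_eq_zero_iff.1 (show ∑ i ∈ Finset.Ico k (k + H), γ i = 0 by omega) (k + j)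
      (Finset.mem_Ico.2 ⟨by omega, by omega⟩)
  have hcount := le_counter_of_forall_eq_zero hs k (H - 1) fun j hj => hzero j (by omega)
  obtain ⟨σ, hσ, hσγ⟩ := hsched (k + (H - 1)) (by omega)
  have hmod := Nat.mod_lt (k + (H - 1)) hM
  have hone := hσ.apply_zero_eq_one (by omega) (by omega)
  have := hzero (H - 1) (by omega)
  omega
end

section
/- Let Q ∈ ℝ^{n_p×n_p} and R, S ∈ ℝ^{m_p×m_p} be symmetric matrices with Q positive definite, S positive definite and R − S positive semidefinite. Define the storage function λ(x) := u_sᵀ S u_s for an NCS state x = (x_p, u_s, β). Then λ is a storage function for the NCS dynamics with respect to the supply rate ℓ: for every state x = (x_p, u_s, β) and every input u = (u_c, γ) with γ ∈ {0,1}, it holds that λ(f(x, u)) − λ(x) ≤ ℓ(x, u). -/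
open Matrix

/-- `λ(x) := u_sᵀ S u_s` is a storage function for the NCS dynamics with
respect to the supply rate `ℓ(x,u) = x_pᵀ Q x_p + (1-γ) u_sᵀ R u_s + γ u_cᵀ R u_c`,
provided `Q > 0`, `S > 0` and `R - S ⪰ 0` (with `R`, `S` symmetric). -/
theorem stmt_8 (np mp : ℕ)
    (A : Matrix (Fin np) (Fin np) ℝ) (B : Matrix (Fin np) (Fin mp) ℝ)
    (g c b : ℤ) (hg : 1 ≤ g) (hc : g ≤ c) (hb : c - g ≤ b)
    (Q : Matrix (Fin np) (Fin np) ℝ) (R S : Matrix (Fin mp) (Fin mp) ℝ)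
    (hQ : Q.PosDef) (hS : S.PosDef) (hR : R.IsSymm) (hRS : (R - S).PosSemidef)
    (x : (Fin np → ℝ) × (Fin mp → ℝ) × ℤ) (u : (Fin mp → ℝ) × ℤ)
    (hγ : u.2 = 0 ∨ u.2 = 1) :
    (ncsF A B g c b x u).2.1 ⬝ᵥ S.mulVec (ncsF A B g c b x u).2.1
        - x.2.1 ⬝ᵥ S.mulVec x.2.1
      ≤ x.1 ⬝ᵥ Q.mulVec x.1 + (1 - (u.2 : ℝ)) * (x.2.1 ⬝ᵥ R.mulVec x.2.1)
        + (u.2 : ℝ) * (u.1 ⬝ᵥ R.mulVec u.1) := by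
  have nonneg : ∀ {n : ℕ} {M : Matrix (Fin n) (Fin n) ℝ}, M.PosSemidef →
      ∀ v : Fin n → ℝ, 0 ≤ v ⬝ᵥ M.mulVec v := fun hM v => by
    simpa using hM.dotProduct_mulVec_nonneg v
  have hle (v : Fin mp → ℝ) : v ⬝ᵥ S.mulVec v ≤ v ⬝ᵥ R.mulVec v := by
    have h := nonneg hRS v
    rw [Matrix.sub_mulVec, dotProduct_sub] at h
    linarith
  have hq := nonneg hQ.posSemidef x.1
  have hs := nonneg hS.posSemidef x.2.1
  have hx := hle x.2.1
  have hu := hle u.1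
  rcases hγ with h | h
  · simp only [ncsF, h, Int.cast_zero, sub_zero, one_smul, zero_smul, add_zero, one_mul, zero_mul]
    linarith
  · simp only [ncsF, h, Int.cast_one, sub_self, one_smul, zero_smul, zero_add, one_mul, zero_mul]
    linarith
end

section
/- Let M ≥ 1 be an integer, X̃ ⊆ ℝ^{n_p}, Ũ ⊆ ℝ^{m_p}, X̄_{f,p} ⊆ X̃ and K_f ∈ ℝ^{m_p×n_p} be such that K_f''X̄_{f,p} ⊆ Ũ, (A_i + B_i K_f)''X̄_{f,p} ⊆ X̃ for all i ∈ {1,…,M−1}, and (A_M + B_M K_f)''X̄_{f,p} ⊆ X̄_{f,p}. Then for every x₀ ∈ X̄_{f,p}, the trajectory defined by x(0) = x₀ and x(i+1) = A x(i) + B K_f x₀ (the plant under the zero-order-held terminal feedback input K_f x₀) satisfies x(i) = (A_i + B_i K_f) x₀ for all i ∈ {0,…,M}; consequently x(i) ∈ X̃ for all i ∈ {0,…,M−1}, the held input satisfies K_f x₀ ∈ Ũ, and x(M) ∈ X̄_{f,p}. -/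
/-- Closed form of the trajectory of `x(i+1) = A x(i) + B K x₀` started at `x₀`. -/
theorem heldInput_trajectory_eq {n m R : Type*} [Fintype n] [DecidableEq n] [Fintype m]
    [CommRing R] (A : Matrix n n R) (B : Matrix n m R) (K : Matrix m n R)
    (x : ℕ → n → R) (x₀ : n → R) (hx0 : x 0 = x₀)
    (hxrec : ∀ i, x (i + 1) = A.mulVec (x i) + B.mulVec (K.mulVec x₀)) (i : ℕ) :
    x i = (A ^ i + (∑ j ∈ Finset.range i, A ^ j) * B * K).mulVec x₀ := by
  induction i with
  | zero => simp [hx0]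
  | succ k ih =>
    have hsum : ∑ j ∈ Finset.range (k + 1), A ^ j
        = A * ∑ j ∈ Finset.range k, A ^ j + 1 := by
      simp [Finset.sum_range_succ', Finset.mul_sum, pow_succ']
    rw [hxrec, ih, hsum, Matrix.mulVec_mulVec, Matrix.mulVec_mulVec, ← Matrix.add_mulVec]
    congr 1
    rw [pow_succ', Matrix.mul_add, Matrix.add_mul, Matrix.add_mul, Matrix.one_mul]
    simp only [Matrix.mul_assoc, add_assoc]

/-- Under the terminal-set conditions (`K_f''X̄_{f,p} ⊆ Ũ`,
`(A_i + B_i K_f)''X̄_{f,p} ⊆ X̃` for `i ∈ {1,…,M-1}`, `(A_M + B_M K_f)''X̄_{f,p} ⊆ X̄_{f,p}`),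
the plant trajectory under the zero-order-held terminal feedback input `K_f x₀` satisfies
`x(i) = (A_i + B_i K_f) x₀` for `i ∈ {0,…,M}`, stays in `X̃` for `i ∈ {0,…,M-1}`, the held
input lies in `Ũ`, and `x(M) ∈ X̄_{f,p}`. -/
theorem stmt_10 (np mp M : ℕ) (hM : 1 ≤ M)
    (A : Matrix (Fin np) (Fin np) ℝ) (B : Matrix (Fin np) (Fin mp) ℝ)
    (Kf : Matrix (Fin mp) (Fin np) ℝ)
    (Xt Xfp : Set (Fin np → ℝ)) (Ut : Set (Fin mp → ℝ))
    (hXfp : Xfp ⊆ Xt)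
    (hU : (fun y => Kf.mulVec y) '' Xfp ⊆ Ut)
    (hXi : ∀ i ∈ Finset.Icc 1 (M - 1),
      (fun y => (A ^ i + (∑ j ∈ Finset.range i, A ^ j) * B * Kf).mulVec y) '' Xfp ⊆ Xt)
    (hXM : (fun y => (A ^ M + (∑ j ∈ Finset.range M, A ^ j) * B * Kf).mulVec y) '' Xfp
      ⊆ Xfp)
    (x₀ : Fin np → ℝ) (hx₀ : x₀ ∈ Xfp)
    (x : ℕ → Fin np → ℝ) (hx0 : x 0 = x₀)
    (hxrec : ∀ i, x (i + 1) = A.mulVec (x i) + B.mulVec (Kf.mulVec x₀)) :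
    (∀ i ≤ M, x i = (A ^ i + (∑ j ∈ Finset.range i, A ^ j) * B * Kf).mulVec x₀) ∧
    (∀ i < M, x i ∈ Xt) ∧ Kf.mulVec x₀ ∈ Ut ∧ x M ∈ Xfp := by
  have key := heldInput_trajectory_eq A B Kf x x₀ hx0 hxrec
  refine ⟨fun i _ => key i, fun i hi => ?_, hU ⟨x₀, hx₀, rfl⟩, ?_⟩
  · rcases Nat.eq_zero_or_pos i with rfl | hpos
    · exact hx0 ▸ hXfp hx₀
    · rw [key i]
      exact hXi i (Finset.mem_Icc.2 ⟨hpos, by omega⟩) ⟨x₀, hx₀, rfl⟩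
  · rw [key M]
    exact hXM ⟨x₀, hx₀, rfl⟩
end

section
/- Let g ≥ 1, c ≥ g, b ≥ c−g be integers and M := ⌈c/g⌉. Consider the M-periodic transmission schedule γ(k) = 1 if k ≡ 0 (mod M) and γ(k) = 0 otherwise, and the token bucket level β(k+1) = min{β(k) + g − γ(k)c, b}. If β(0) ∈ [c−g, b], then β(k) ∈ [0, b] for all k ∈ ℕ, and moreover β(jM) ∈ [c−g, b] for every j ∈ ℕ; i.e., the set of bucket levels [c−g, b] is invariant over each period under the M-periodic terminal schedule, and the token bucket traffic specification is fulfilled for all times. -/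
/-- Under the `M`-periodic transmission schedule (`M = ⌈c/g⌉`) that
transmits exactly when `k ≡ 0 (mod M)`, if the initial bucket level satisfies
`β(0) ∈ [c-g, b]`, then the token bucket traffic specification `β(k) ∈ [0, b]` is
fulfilled for all times, and `β(jM) ∈ [c-g, b]` at every period start. -/
theorem stmt_11 (g c b : ℤ) (hg : 1 ≤ g) (hc : g ≤ c) (hb : c - g ≤ b)
    (M : ℕ) (hM : (M : ℤ) = ⌈(c : ℚ) / (g : ℚ)⌉)
    (γ : ℕ → ℤ) (hγ : ∀ k, γ k = if k % M = 0 then 1 else 0)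
    (β : ℕ → ℤ) (hβrec : ∀ k, β (k + 1) = min (β k + g - γ k * c) b)
    (hβ0 : c - g ≤ β 0 ∧ β 0 ≤ b) :
    (∀ k, 0 ≤ β k ∧ β k ≤ b) ∧ (∀ j : ℕ, c - g ≤ β (j * M) ∧ β (j * M) ≤ b) := by
  have hgq : (0 : ℚ) < (g : ℚ) := by exact_mod_cast hg
  have hcM : c ≤ M * g := by
    have h : (c : ℚ) / g ≤ ((M : ℤ) : ℚ) := by
      rw [hM]
      exact Int.le_ceil _
    rw [div_le_iff₀ hgq] at h
    exact_mod_cast h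
  have hMpos : 0 < M := by
    rcases Nat.eq_zero_or_pos M with h | h
    · subst h
      simp at hcM
      omega
    · exact h
  have hupper : ∀ k, β k ≤ b := by
    intro k
    cases k with
    | zero => exact hβ0.2
    | succ k =>
      rw [hβrec]
      exact min_le_right _ _
  have hperiod : ∀ j : ℕ, c - g ≤ β (j * M) →
      ∀ i : ℕ, i + 1 ≤ M → min (i * g) (c - g) ≤ β (j * M + i + 1) := by
    intro j hj i
    induction i with
    | zero =>
      intro _
      have hγj : γ (j * M) = 1 := by simp [hγ]
      rw [add_zero, hβrec, hγj]
      push_cast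
      omega
    | succ i ih =>
      intro hi
      have hγi : γ (j * M + i + 1) = 0 := by
        rw [hγ, add_assoc, Nat.mul_add_mod', Nat.mod_eq_of_lt (by omega)]
        simp
      have hlevel := ih (by omega)
      rw [← add_assoc, hβrec, hγi]
      push_cast
      rw [add_one_mul]
      omega
  have hstart : ∀ j : ℕ, c - g ≤ β (j * M) := by
    intro j
    induction j with
    | zero => simpa using hβ0.1
    | succ j ih =>
      have h := hperiod j ih (M - 1) (by omega)
      have hidx : j * M + (M - 1) + 1 = (j + 1) * M := by
        rw [add_one_mul]
        omega
      rw [hidx, Nat.cast_sub hMpos, Nat.cast_one, sub_one_mul] at h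
      omega
  refine ⟨fun k => ⟨?_, hupper k⟩, fun j => ⟨hstart j, hupper _⟩⟩
  have hk := Nat.div_add_mod' k M
  have hlt := Nat.mod_lt k hMpos
  rcases Nat.eq_zero_or_pos (k % M) with h0 | h0
  · have h := hstart (k / M)
    rw [h0, add_zero] at hk
    rw [hk] at h
    omega
  · have h := hperiod (k / M) (hstart _) (k % M - 1) (by omega)
    have hidx : k / M * M + (k % M - 1) + 1 = k := by omega
    rw [hidx] at h
    have hnonneg : 0 ≤ ((k % M - 1 : ℕ) : ℤ) * g := by positivity
    omega
end
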